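/- Let T be a tree with adjacency matrix A, and let R be the set of vertices v of T such that some vector x in the null space of A satisfies x(v) ≠ 0. Then the nullity of T equals the number of connected components of the induced subgraph T[R] minus the number of vertices of T that do not belong to R but are adjacent in T to some vertex of R. -/

import Mathlib

open SimpleGraph

open scoped Classical

/-- The real adjacency matrix of a simple graph. -/
noncomputable def adjMat {V : Type*} (G : SimpleGraph V) : Matrix V V ℝ :=
  fun u v => if G.Adj u v then 1 else 0

/-- The eigenspace `{x : A x = μ x}` of the adjacency matrix of `G`. -/
noncomputable def eigSpace {V : Type*} [Fintype V] (G : SimpleGraph V) (μ : ℝ) :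
    Submodule ℝ (V → ℝ) :=
  LinearMap.ker ((adjMat G).mulVecLin - μ • LinearMap.id)

/-- `x` is an eigenvector of `G` for eigenvalue `μ`. -/
def IsEigenvector {V : Type*} [Fintype V] (G : SimpleGraph V) (μ : ℝ) (x : V → ℝ) : Prop :=
  x ≠ 0 ∧ (adjMat G).mulVec x = μ • x

/-- `N_μ(G)`: vertices on which every eigenvector of `G` for `μ` vanishes. -/
def nSet {V : Type*} [Fintype V] (G : SimpleGraph V) (μ : ℝ) : Set V :=
  {v | ∀ x : V → ℝ, IsEigenvector G μ x → x v = 0}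

/-- `N^C_μ(G)`: vertices of `N_μ(G)` with a neighbor outside `N_μ(G)`. -/
def ncSet {V : Type*} [Fintype V] (G : SimpleGraph V) (μ : ℝ) : Set V :=
  {v | v ∈ nSet G μ ∧ ∃ w, G.Adj v w ∧ w ∉ nSet G μ}

/-- `C` is the vertex set of a connected component of the induced subgraph `G[S]`. -/
def IsCompOf {V : Type*} (G : SimpleGraph V) (S C : Set V) : Prop :=
  ∃ c : (G.induce S).ConnectedComponent, C = Subtype.val '' c.supp

theorem exists_ne_of_sum_eq_zero {ι : Type*} {s : Finset ι} {f : ι → ℝ} (h : ∑ i ∈ s, f i = 0)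
    {a : ι} (ha : a ∈ s) (hfa : f a ≠ 0) : ∃ b ∈ s, b ≠ a ∧ f b ≠ 0 := by
  by_contra! hb
  exact hfa ((Finset.sum_eq_single_of_mem a ha hb).symm.trans h)

theorem adjMat_mulVec_apply {V : Type*} [Fintype V] (G : SimpleGraph V) (x : V → ℝ) (v : V) :
    (adjMat G).mulVec x v = ∑ w, if G.Adj v w then x w else 0 := by
  simp [Matrix.mulVec, dotProduct, adjMat]

theorem mem_eigSpace_zero {V : Type*} [Fintype V] {G : SimpleGraph V} {x : V → ℝ} :
    x ∈ eigSpace G 0 ↔ (adjMat G).mulVec x = 0 := by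
  simp [eigSpace]

/-- In a finite acyclic graph no nonempty vertex set induces minimum degree at least two. -/
theorem SimpleGraph.IsAcyclic.not_forall_exists_two_neighbors {V : Type*} [Finite V]
    {G : SimpleGraph V} (hG : G.IsAcyclic) {S : Set V} (hS : S.Nonempty) :
    ¬ ∀ v ∈ S, ∃ a ∈ S, ∃ b ∈ S, a ≠ b ∧ G.Adj v a ∧ G.Adj v b := by
  intro h
  have hH := hG.induce S
  have : Nonempty S := hS.to_subtype
  obtain ⟨u, v, p, hp, hmax⟩ := Walk.exists_isPath_forall_isPath_length_le_length (G.induce S)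
  have key : ∀ a : S, (G.induce S).Adj u a → a = p.snd := by
    intro a ha
    by_cases hs : a ∈ p.support
    · exact hH.eq_snd_of_adj_start hp ha hs
    · have := hmax _ _ (Walk.cons ha.symm p) (hp.cons hs)
      simp at this
  obtain ⟨a, haS, b, hbS, hab, hua, hub⟩ := h u u.2
  have := (key ⟨a, haS⟩ hua).trans (key ⟨b, hbS⟩ hub).symm
  exact hab (congrArg Subtype.val this)

/-- Green's identity across a bridge. -/
theorem mul_eq_mul_of_isBridge {V : Type*} [Fintype V] {G : SimpleGraph V} {u v : V}
    (huv : G.Adj u v) (hb : G.IsBridge s(u, v)) {x y : V → ℝ}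
    (hx : (adjMat G).mulVec x = 0) (hy : (adjMat G).mulVec y = 0) :
    y u * x v = x u * y v := by
  set P : Finset V := {w | (G.deleteEdges {s(u, v)}).Reachable u w} with hP
  have huP : u ∈ P := by simp [hP]
  have hvP : v ∈ Pᶜ := by simpa [hP] using isBridge_iff.mp hb
  have hcut : ∀ w ∈ P, ∀ z ∈ Pᶜ, G.Adj w z → w = u ∧ z = v := by
    intro w hw z hz hwz
    by_cases he : s(w, z) = s(u, v)
    · rcases Sym2.eq_iff.mp he with h | ⟨rfl, -⟩
      · exact h
      · exact absurd hw (Finset.mem_compl.mp hvP)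
    · exfalso
      have hw' : (G.deleteEdges {s(u, v)}).Reachable u w := by simpa [hP] using hw
      have hz' : ¬ (G.deleteEdges {s(u, v)}).Reachable u z := by simpa [hP] using hz
      refine hz' (hw'.trans (Adj.reachable ?_))
      rw [deleteEdges_adj]
      exact ⟨hwz, he⟩
  set F : V → V → ℝ := fun w z => if G.Adj w z then y w * x z - x w * y z else 0 with hF
  have hanti : ∀ w z, F w z = - F z w := by
    intro w z
    simp only [hF, G.adj_comm w z]
    split_ifs <;> ring
  have hrow : ∀ w, ∑ z, F w z = 0 := by
    intro w
    have h1 := congrFun hx w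
    have h2 := congrFun hy w
    rw [adjMat_mulVec_apply, Pi.zero_apply] at h1 h2
    have : ∀ z, F w z =
        y w * (if G.Adj w z then x z else 0) - x w * (if G.Adj w z then y z else 0) := by
      intro z
      simp only [hF]
      split_ifs <;> ring
    simp only [this, Finset.sum_sub_distrib, ← Finset.mul_sum, h1, h2]
    ring
  have hin : ∑ w ∈ P, ∑ z ∈ P, F w z = 0 := by
    have h1 : ∑ w ∈ P, ∑ z ∈ P, F w z = - ∑ w ∈ P, ∑ z ∈ P, F w z := by
      simp only [← Finset.sum_neg_distrib, ← hanti]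
      exact Finset.sum_comm
    linarith
  have hout : ∑ w ∈ P, ∑ z ∈ Pᶜ, F w z = 0 := by
    have : ∑ w ∈ P, ∑ z, F w z = 0 := Finset.sum_eq_zero fun w _ => hrow w
    simp only [← Finset.sum_add_sum_compl P, Finset.sum_add_distrib, hin, zero_add] at this
    exact this
  have hone : ∑ w ∈ P, ∑ z ∈ Pᶜ, F w z = F u v := by
    rw [Finset.sum_eq_single_of_mem u huP, Finset.sum_eq_single_of_mem v hvP]
    · intro z hz hzv
      exact if_neg fun h => hzv (hcut u huP z hz h).2
    · intro w hw hwu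
      exact Finset.sum_eq_zero fun z hz => if_neg fun h => hwu (hcut w hw z hz h).1
  rw [hone] at hout
  simp only [hF, huv, if_true] at hout
  linarith

/-- Restricting a null vector of a bipartite graph to one colour class gives a null vector. -/
theorem mulVec_ite_color_eq_zero {V : Type*} [Fintype V] {G : SimpleGraph V}
    (col : G.Coloring (Fin 2)) (i : Fin 2) {x : V → ℝ} (hx : (adjMat G).mulVec x = 0) :
    (adjMat G).mulVec (fun v => if col v = i then x v else 0) = 0 := by
  funext w
  have h := congrFun hx w
  rw [adjMat_mulVec_apply, Pi.zero_apply] at h ⊢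
  by_cases hw : col w = i
  · refine Finset.sum_eq_zero fun z _ => ?_
    have : G.Adj w z → col w ≠ col z := col.valid
    grind
  · rw [← h]
    refine Finset.sum_congr rfl fun z _ => ?_
    have : G.Adj w z → col w ≠ col z := col.valid
    have : G.Adj w z → col z = i := fun hz => by
      have := this hz
      omega
    grind

/-- In a forest, two adjacent vertices cannot both lie in the support of the null space. -/
theorem SimpleGraph.IsAcyclic.not_adj_of_mem_null_support {V : Type*} [Fintype V]
    {G : SimpleGraph V} (hG : G.IsAcyclic) {u v : V} {x y : V → ℝ}
    (hx : (adjMat G).mulVec x = 0) (hy : (adjMat G).mulVec y = 0)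
    (hxu : x u ≠ 0) (hyv : y v ≠ 0) : ¬ G.Adj u v := by
  intro huv
  obtain ⟨col⟩ := hG.colorable_two
  have h := mul_eq_mul_of_isBridge huv (isAcyclic_iff_forall_adj_isBridge.mp hG huv)
    (mulVec_ite_color_eq_zero col (col u) hx) (mulVec_ite_color_eq_zero col (col v) hy)
  have hne := col.valid huv
  simp [hne, hxu, hyv] at h

theorem card_connectedComponent_induce_of_isIndepSet {V : Type*} {G : SimpleGraph V} {R : Set V}
    (hR : ∀ u ∈ R, ∀ v ∈ R, ¬ G.Adj u v) :
    Nat.card (G.induce R).ConnectedComponent = Nat.card R := by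
  have hbot : G.induce R = ⊥ := by
    ext u v
    simpa using hR u u.2 v v.2
  rw [hbot]
  refine (Nat.card_congr (Equiv.ofBijective (connectedComponentMk ⊥) ⟨?_, ?_⟩)).symm
  · intro a b h
    exact reachable_bot.mp (ConnectedComponent.exact h)
  · exact Quot.mk_surjective

/-- The rows indexed by `C` and columns indexed by `R` of the adjacency matrix. -/
noncomputable def biadjMat {V : Type*} (G : SimpleGraph V) (C R : Set V) : Matrix C R ℝ :=
  (adjMat G).submatrix Subtype.val Subtype.val

theorem adjMat_mulVec_extend {V : Type*} [Fintype V] (G : SimpleGraph V) {R : Set V}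
    (z : R → ℝ) (v : V) :
    (adjMat G).mulVec (Function.extend Subtype.val z 0) v = ∑ w : R, adjMat G v w * z w := by
  simp only [Matrix.mulVec, dotProduct]
  rw [← Finset.sum_subset R.toFinset.subset_univ,
    Finset.sum_subtype (p := (· ∈ R)) _ (by simp)]
  · refine Finset.sum_congr rfl fun w _ => ?_
    rw [Subtype.val_injective.extend_apply]
  · intro w _ hw
    rw [Function.extend_apply', Pi.zero_apply, mul_zero]
    rintro ⟨r, rfl⟩
    simp at hw

/-- If null vectors are supported on an independent set `R`, then only the equations at the outer
boundary of `R` matter. -/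
theorem finrank_eigSpace_zero_eq {V : Type*} [Fintype V] {G : SimpleGraph V} {R : Set V}
    (hind : ∀ u ∈ R, ∀ v ∈ R, ¬ G.Adj u v)
    (hsupp : ∀ x, (adjMat G).mulVec x = 0 → ∀ v ∉ R, x v = 0) :
    Module.finrank ℝ (eigSpace G 0) = Module.finrank ℝ
      (LinearMap.ker (biadjMat G {v | v ∉ R ∧ ∃ w ∈ R, G.Adj v w} R).mulVecLin) := by
  set C : Set V := {v | v ∉ R ∧ ∃ w ∈ R, G.Adj v w} with hC
  let E : (R → ℝ) →ₗ[ℝ] (V → ℝ) := Function.ExtendByZero.linearMap ℝ Subtype.val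
  have hE : ∀ z, E z = Function.extend Subtype.val z 0 := fun _ => rfl
  have hinj : Function.Injective E := by
    intro a b hab
    funext r
    have := congrFun hab r
    simpa [hE, Subtype.val_injective.extend_apply] using this
  have hB : ∀ z (c : C), (biadjMat G C R).mulVec z c = (adjMat G).mulVec (E z) c := by
    intro z c
    rw [hE, adjMat_mulVec_extend]
    rfl
  have hmap : eigSpace G 0 = (LinearMap.ker (biadjMat G C R).mulVecLin).map E := by
    ext x
    simp only [mem_eigSpace_zero, Submodule.mem_map, LinearMap.mem_ker, Matrix.mulVecLin_apply]
    constructor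
    · intro hx
      have hEx : E (fun r => x r) = x := by
        funext v
        by_cases hv : v ∈ R
        · exact Subtype.val_injective.extend_apply (fun r : R => x r) 0 ⟨v, hv⟩
        · rw [hsupp x hx v hv, hE, Function.extend_apply', Pi.zero_apply]
          rintro ⟨r, rfl⟩
          exact hv r.2
      refine ⟨_, ?_, hEx⟩
      funext c
      rw [hB, hEx, hx]
      rfl
    · rintro ⟨z, hz, rfl⟩
      funext v
      by_cases hv : v ∈ C
      · rw [← hB z ⟨v, hv⟩, hz]
        rfl
      · rw [hE, adjMat_mulVec_extend]
        refine Finset.sum_eq_zero fun w _ => ?_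
        have : ¬ G.Adj v w := by
          intro h
          by_cases hvR : v ∈ R
          · exact hind v hvR w w.2 h
          · exact hv ⟨hvR, w, w.2, h⟩
        simp [adjMat, this]
  rw [hmap]
  exact (Submodule.equivMapOfInjective E hinj _).finrank_eq.symm

/-- In a forest, if every vertex of `C` has two neighbours in `R`,
then the corresponding block of the adjacency matrix has independent rows. -/
theorem SimpleGraph.IsAcyclic.biadjMat_transpose_mulVec_eq_zero {V : Type*} [Fintype V]
    {G : SimpleGraph V} (hG : G.IsAcyclic) {C R : Set V}
    [Fintype C] (hC : ∀ c ∈ C, ∃ a ∈ R, ∃ b ∈ R, a ≠ b ∧ G.Adj c a ∧ G.Adj c b)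
    {y : C → ℝ} (hy : (biadjMat G C R).transpose.mulVec y = 0) : y = 0 := by
  by_contra hne
  obtain ⟨c₀, hc₀⟩ := Function.ne_iff.mp hne
  let Y : Set V := {v | ∃ h : v ∈ C, y ⟨v, h⟩ ≠ 0}
  let N : Set V := {r | r ∈ R ∧ ∃ c ∈ Y, G.Adj r c}
  have hcY : (c₀ : V) ∈ Y := ⟨c₀.2, hc₀⟩
  refine hG.not_forall_exists_two_neighbors (S := Y ∪ N) ⟨c₀, Or.inl hcY⟩ ?_
  rintro v (hv | ⟨hvR, c, ⟨hcC, hyc⟩, hvc⟩)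
  · obtain ⟨a, ha, b, hb, hab, hva, hvb⟩ := hC v hv.1
    exact ⟨a, Or.inr ⟨ha, v, hv, hva.symm⟩, b, Or.inr ⟨hb, v, hv, hvb.symm⟩, hab, hva, hvb⟩
  · have hsum := congrFun hy ⟨v, hvR⟩
    simp only [Matrix.mulVec, dotProduct, Pi.zero_apply, Matrix.transpose_apply] at hsum
    obtain ⟨d, -, hdc, hd⟩ := exists_ne_of_sum_eq_zero hsum (Finset.mem_univ ⟨c, hcC⟩)
      (by simp [biadjMat, adjMat, hvc.symm, hyc])
    have hdv : G.Adj v d := by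
      by_contra h
      exact hd (by simp [biadjMat, adjMat, G.adj_comm d, h])
    refine ⟨c, Or.inl ⟨hcC, hyc⟩, d, Or.inl ⟨d.2, right_ne_zero_of_mul hd⟩, ?_, hvc, hdv⟩
    rintro rfl
    exact hdc rfl

theorem finrank_ker_mulVecLin_add_card {m n : Type*} [Fintype m] [Fintype n] {B : Matrix m n ℝ}
    (hB : ∀ y, B.transpose.mulVec y = 0 → y = 0) :
    Module.finrank ℝ (LinearMap.ker B.mulVecLin) + Nat.card m = Nat.card n := by
  have hker : LinearMap.ker B.transpose.mulVecLin = ⊥ :=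
    (Submodule.eq_bot_iff _).mpr fun y hy => hB y hy
  have h1 := B.mulVecLin.finrank_range_add_finrank_ker
  have h2 := B.transpose.mulVecLin.finrank_range_add_finrank_ker
  have h3 := B.rank_transpose
  simp only [Matrix.rank] at h3
  rw [hker, finrank_bot] at h2
  rw [Module.finrank_fintype_fun_eq_card, ← Nat.card_eq_fintype_card] at h1 h2
  omega

theorem stmt_14 {V : Type*} [Fintype V] (G : SimpleGraph V) (hT : G.IsTree)
    (R : Set V) (hR : R = {v | ∃ x : V → ℝ, (adjMat G).mulVec x = 0 ∧ x v ≠ 0}) :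
    (Module.finrank ℝ (eigSpace G 0) : ℤ) =
      Nat.card (G.induce R).ConnectedComponent -
        ({v | v ∉ R ∧ ∃ w ∈ R, G.Adj v w} : Set V).ncard := by
  have hsupp : ∀ x, (adjMat G).mulVec x = 0 → ∀ v ∉ R, x v = 0 := by
    intro x hx v hv
    by_contra h
    exact hv (hR ▸ ⟨x, hx, h⟩)
  have hex : ∀ v ∈ R, ∃ x : V → ℝ, (adjMat G).mulVec x = 0 ∧ x v ≠ 0 := by
    intro v hv
    rwa [hR] at hv
  have hind : ∀ u ∈ R, ∀ v ∈ R, ¬ G.Adj u v := by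
    intro u hu v hv
    obtain ⟨x, hx, hxu⟩ := hex u hu
    obtain ⟨y, hy, hyv⟩ := hex v hv
    exact hT.isAcyclic.not_adj_of_mem_null_support hx hy hxu hyv
  have htwo : ∀ c ∈ ({v | v ∉ R ∧ ∃ w ∈ R, G.Adj v w} : Set V),
      ∃ a ∈ R, ∃ b ∈ R, a ≠ b ∧ G.Adj c a ∧ G.Adj c b := by
    rintro c ⟨-, a, ha, hca⟩
    obtain ⟨x, hx, hxa⟩ := hex a ha
    have hsum := congrFun hx c
    rw [adjMat_mulVec_apply, Pi.zero_apply] at hsum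
    obtain ⟨b, -, hba, hb⟩ := exists_ne_of_sum_eq_zero hsum (Finset.mem_univ a) (by simp [hca, hxa])
    rw [ne_eq, ite_eq_right_iff, Classical.not_imp] at hb
    refine ⟨a, ha, b, ?_, hba.symm, hca, hb.1⟩
    by_contra h
    exact hb.2 (hsupp x hx b h)
  have hcard := finrank_ker_mulVecLin_add_card
    fun y => hT.isAcyclic.biadjMat_transpose_mulVec_eq_zero htwo (y := y)
  rw [← finrank_eigSpace_zero_eq hind hsupp] at hcard
  rw [card_connectedComponent_induce_of_isIndepSet hind, ← Nat.card_coe_set_eq]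
  omega
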